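/- arXiv:1406.2699 — 7 statements merged into one kernel-verified Lean document; each statement's English description precedes it below -/
import Mathlib

section
/- Let b_ik, b_kj, b_ij be integers. Define b'_ij = b_ij + sign(b_ik)·[b_ik·b_kj]_+ and a_ij = [−sign(b_ij·b_ik)]_+ · min(|b_ij|, [b_ik·b_kj]_+). Then a_ij ≡ [b'_ij]_+ + [b_ij]_+ + [b_ik]_+·[b_kj]_+ (mod 2). -/
theorem stmt0 (bik bkj bij : ℤ) :
    max (-(Int.sign (bij * bik))) 0 * min |bij| (max (bik * bkj) 0) ≡
      max (bij + Int.sign bik * max (bik * bkj) 0) 0 + max bij 0 + max bik 0 * max bkj 0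
      [ZMOD 2] := by
  rw [Int.sign_mul]
  have key : max bik 0 * max bkj 0 = if 0 < bik then max (bik * bkj) 0 else 0 := by
    split_ifs with h
    · rw [max_eq_left h.le, mul_max_of_nonneg _ _ h.le, mul_zero]
    · rw [max_eq_right (not_lt.mp h), zero_mul]
  rw [key]
  have hp : 0 ≤ max (bik * bkj) 0 := le_max_right _ _
  have hz : bik = 0 → max (bik * bkj) 0 = 0 := by rintro rfl; simp
  generalize max (bik * bkj) 0 = p at *
  unfold Int.ModEq
  rcases lt_trichotomy bik 0 with h | h | h <;>
  rcases lt_trichotomy bij 0 with g | g | g <;>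
  simp only [Int.sign_eq_neg_one_of_neg, Int.sign_eq_one_of_pos, Int.sign_zero, h, g, abs_of_neg, abs_of_pos, abs_zero] <;>
  norm_num <;> (try split_ifs) <;> first | done | omega
end

section
/- Let n ≥ 1, let B = (b_ij) be an n×n skew-symmetric integer matrix, let N_1,…,N_n be integers, and fix an index k. Define β_i = −∑_j b_ij·N_j, let B' = μ_k(B), and set N'_k = max(∑_j [b_kj]_+·N_j, ∑_j [−b_kj]_+·N_j) − N_k and N'_i = N_i for i ≠ k. Define β'_i = −∑_j b'_ij·N'_j. Then β'_k = −β_k, and for every i ≠ k, β'_i = β_i + [b_ki]_+·β_k − b_ki·[β_k]_+. -/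
theorem stmt10 (n : ℕ) (hn : 1 ≤ n) (B B' : Fin n → Fin n → ℤ)
    (hskew : ∀ i j, B j i = -B i j)
    (N N' β β' : Fin n → ℤ) (k : Fin n)
    (hβ : ∀ i, β i = -∑ j, B i j * N j)
    (hB' : ∀ i j, B' i j = if i = k ∨ j = k then -B i j
        else B i j + Int.sign (B i k) * max (B i k * B k j) 0)
    (hN' : ∀ i, N' i = if i = k
        then max (∑ j, max (B k j) 0 * N j) (∑ j, max (-(B k j)) 0 * N j) - N k
        else N i)
    (hβ' : ∀ i, β' i = -∑ j, B' i j * N' j) :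
    β' k = -β k ∧ ∀ i, i ≠ k → β' i = β i + max (B k i) 0 * β k - B k i * max (β k) 0 := by
  have hkk : B k k = 0 := by have := hskew k k; omega
  have hPQ : β k = (∑ j, max (-(B k j)) 0 * N j) - ∑ j, max (B k j) 0 * N j := by
    rw [hβ, ← Finset.sum_neg_distrib, ← Finset.sum_sub_distrib]
    refine Finset.sum_congr rfl fun j _ => ?_
    rcases le_total (B k j) 0 with h | h
    · rw [max_eq_left (by omega : (0:ℤ) ≤ -(B k j)), max_eq_right h]; ring
    · rw [max_eq_right (by omega : -(B k j) ≤ (0:ℤ)), max_eq_left h]; ring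
  generalize hP : (∑ j, max (B k j) 0 * N j) = P at *
  generalize hQ : (∑ j, max (-(B k j)) 0 * N j) = Q at *
  refine ⟨?_, fun i hi => ?_⟩
  · rw [hβ', hβ, ← Finset.sum_neg_distrib, neg_neg]
    refine Finset.sum_congr rfl fun j _ => ?_
    rw [hB', hN']
    by_cases hj : j = k
    · subst hj; simp [hkk]
    · simp [hj]
  · have key : ∀ c : Fin n → ℤ, c k = 0 →
        (∀ j, Int.sign (B i k) * max (B i k * B k j) 0 = B i k * c j) →
        β' i = β i - B i k * (∑ j, c j * N j) + B i k * max P Q := by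
      intro c hck hc
      have h1 : ∀ j, B' i j * N' j
          = B i j * N j + B i k * (c j * N j) - (if j = k then B i k * max P Q else 0) := by
        intro j
        rw [hB', hN', hc]
        by_cases hj : j = k
        · subst hj; simp [hck]; ring
        · simp [hj, hi]; ring
      rw [hβ', hβ, Finset.sum_congr rfl fun j _ => h1 j, Finset.sum_sub_distrib,
        Finset.sum_add_distrib, ← Finset.mul_sum]
      simp
      ring
    rw [hskew i k]
    rcases le_or_gt (B i k) 0 with h | h
    · have := key (fun j => max (-(B k j)) 0) (by simp [hkk]) (by
        intro j
        rcases h.lt_or_eq with h | h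
        · rw [Int.sign_eq_neg_one_of_neg h]
          rcases le_total (B k j) 0 with h' | h'
          · rw [max_eq_left (mul_nonneg_of_nonpos_of_nonpos h.le h'),
              max_eq_left (by omega : (0:ℤ) ≤ -(B k j))]; ring
          · rw [max_eq_right (mul_nonpos_of_nonpos_of_nonneg h.le h'),
              max_eq_right (by omega : -(B k j) ≤ (0:ℤ))]; ring
        · simp [h])
      rw [this, hQ, hPQ, max_eq_left (by omega : (0:ℤ) ≤ -(B i k))]
      rcases le_total P Q with h' | h'
      · rw [max_eq_right h', max_eq_left (by omega : (0:ℤ) ≤ Q - P)]; ring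
      · rw [max_eq_left h', max_eq_right (by omega : Q - P ≤ (0:ℤ))]; ring
    · have := key (fun j => max (B k j) 0) (by simp [hkk]) (by
        intro j
        rw [Int.sign_eq_one_of_pos h]
        rcases le_total (B k j) 0 with h' | h'
        · rw [max_eq_right (mul_nonpos_of_nonneg_of_nonpos h.le h'), max_eq_right h']; ring
        · rw [max_eq_left (mul_nonneg h.le h'), max_eq_left h']; ring)
      rw [this, hP, hPQ, max_eq_right (by omega : -(B i k) ≤ (0:ℤ))]
      rcases le_total P Q with h' | h'
      · rw [max_eq_right h', max_eq_left (by omega : (0:ℤ) ≤ Q - P)]; ring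
      · rw [max_eq_left h', max_eq_right (by omega : Q - P ≤ (0:ℤ))]; ring
end

section
/- Let K be a field, n ≥ 1, B = (b_ij) an n×n skew-symmetric integer matrix, and x_1,…,x_n nonzero elements of K. Fix an index k and assume S := ∏_j x_j^{[b_jk]_+} + ∏_j x_j^{[−b_jk]_+} is nonzero. Define the mutated cluster by x'_k = S/x_k and x'_i = x_i for i ≠ k, and let B' = μ_k(B). Define z_i = ∏_j x_j^{b_ji} and z'_i = ∏_j (x'_j)^{b'_ji} (integer powers in K). Then z'_k = z_k^{−1}, and for every i ≠ k, 1 + z_k ≠ 0 and z'_i = z_i · z_k^{[b_ki]_+} · (1 + z_k)^{−b_ki}. -/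
theorem stmt11 (K : Type*) [Field K] (n : ℕ) (hn : 1 ≤ n)
    (B B' : Fin n → Fin n → ℤ) (hskew : ∀ i j, B j i = -B i j)
    (x x' z z' : Fin n → K) (hx : ∀ j, x j ≠ 0) (k : Fin n)
    (S : K)
    (hS : S = ∏ j, x j ^ max (B j k) 0 + ∏ j, x j ^ max (-(B j k)) 0)
    (hSne : S ≠ 0)
    (hx' : ∀ i, x' i = if i = k then S / x k else x i)
    (hB' : ∀ i j, B' i j = if i = k ∨ j = k then -B i j
        else B i j + Int.sign (B i k) * max (B i k * B k j) 0)
    (hz : ∀ i, z i = ∏ j, x j ^ B j i)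
    (hz' : ∀ i, z' i = ∏ j, x' j ^ B' j i) :
    z' k = (z k)⁻¹ ∧ ∀ i, i ≠ k → 1 + z k ≠ 0 ∧
      z' i = z i * z k ^ max (B k i) 0 * (1 + z k) ^ (-(B k i)) := by
  have hkk : B k k = 0 := by have := hskew k k; omega
  have hP : (∏ j, x j ^ max (B j k) 0) ≠ 0 :=
    Finset.prod_ne_zero_iff.mpr fun j _ => zpow_ne_zero _ (hx j)
  have hM : (∏ j, x j ^ max (-(B j k)) 0) ≠ 0 :=
    Finset.prod_ne_zero_iff.mpr fun j _ => zpow_ne_zero _ (hx j)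
  have hzk : z k = (∏ j, x j ^ max (B j k) 0) / (∏ j, x j ^ max (-(B j k)) 0) := by
    rw [hz, ← Finset.prod_div_distrib]
    refine Finset.prod_congr rfl fun j _ => ?_
    rw [← zpow_sub₀ (hx j)]
    congr 1
    omega
  have key : ∀ i, i ≠ k → z' i = z i * (∏ j, x j ^ max (B j k) 0) ^ max (B k i) 0
      * (∏ j, x j ^ max (-(B j k)) 0) ^ (-max (-(B k i)) 0) * S ^ (-(B k i)) := by
    intro i hi
    have h1 : S ^ (-(B k i)) = ∏ j, if j = k then S ^ (-(B k i)) else 1 := by simp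
    rw [hz', hz, h1, ← Finset.prod_zpow, ← Finset.prod_zpow, ← Finset.prod_mul_distrib,
      ← Finset.prod_mul_distrib, ← Finset.prod_mul_distrib]
    refine Finset.prod_congr rfl fun j _ => ?_
    rw [hx', hB']
    by_cases hj : j = k
    · subst hj
      simp [hkk, mul_zpow, div_eq_mul_inv, mul_comm]
    · simp only [hj, hi, if_false, or_self, mul_one]
      rw [← zpow_mul, ← zpow_mul, ← zpow_add₀ (hx j), ← zpow_add₀ (hx j)]
      congr 1
      generalize B j k = a
      generalize B k i = c
      rw [add_assoc]
      congr 1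
      rcases lt_trichotomy a 0 with ha | ha | ha
      · rw [Int.sign_eq_neg_one_of_neg ha, max_eq_right ha.le, max_eq_left (by omega : 0 ≤ -a)]
        rcases le_total c 0 with hc | hc
        · rw [max_eq_left (by nlinarith : 0 ≤ a * c), max_eq_left (by omega : 0 ≤ -c)]
          ring
        · rw [max_eq_right (by nlinarith : a * c ≤ 0), max_eq_right (by omega : -c ≤ 0)]
          ring
      · simp [ha]
      · rw [Int.sign_eq_one_of_pos ha, max_eq_left ha.le, max_eq_right (by omega : -a ≤ 0)]
        rcases le_total c 0 with hc | hc
        · rw [max_eq_right (by nlinarith : a * c ≤ 0), max_eq_right hc]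
          ring
        · rw [max_eq_left (by nlinarith : 0 ≤ a * c), max_eq_left hc]
          ring
  refine ⟨?_, fun i hi => ?_⟩
  · rw [hz', hz, ← Finset.prod_inv_distrib]
    refine Finset.prod_congr rfl fun j _ => ?_
    rw [hx', hB']
    by_cases hj : j = k
    · subst hj
      simp [hkk]
    · simp [hj]
  · have key := key i hi
    generalize (∏ j, x j ^ max (B j k) 0) = P at *
    generalize (∏ j, x j ^ max (-(B j k)) 0) = M at *
    have h1 : 1 + z k = S / M := by
      rw [hzk, hS]
      field_simp
      ring
    refine ⟨h1 ▸ div_ne_zero hSne hM, ?_⟩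
    have e : -max (-(B k i)) 0 = -max (B k i) 0 + B k i := by omega
    rw [key, h1, hzk, e, zpow_add₀ hM, div_zpow, div_zpow, zpow_neg M, zpow_neg M]
    simp only [div_eq_mul_inv, inv_inv]
    ring
end

section
/- Let n ≥ 1, let B = (b_ij) be an n×n skew-symmetric integer matrix, N_1,…,N_n natural numbers, and z_1,…,z_n nonzero complex numbers. Set N_f(i) = ∑_j [b_ij]_+·N_j, N_a(i) = ∑_j [−b_ij]_+·N_j, β_i = N_a(i) − N_f(i), and C_i(w) = 1 if β_i < 0, C_i(w) = 1 + w if β_i = 0, and C_i(w) = 𝒾^{β_i}·w if β_i > 0 (𝒾 the imaginary unit); assume z_i ≠ −1 whenever β_i = 0. Suppose (Q_i, T_i) is a strong solution of the vacuum equations: each Q_i ∈ ℂ[x] is monic of degree N_i, each T_i is monic of degree max(N_f(i), N_a(i)) − N_i, for every i one has ∏_j Q_j^{[b_ij]_+} + 𝒾^{β_i}·z_i·∏_j Q_j^{[−b_ij]_+} = C_i(z_i)·Q_i·T_i, each Q_i is squarefree, and Q_i and Q_j are coprime whenever b_ij ≠ 0. Fix k with N_k ≤ max(N_f(k), N_a(k)),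 let B' = μ_k(B), set N'_k = max(N_f(k), N_a(k)) − N_k and N'_i = N_i for i ≠ k, define z'_k = z_k^{−1} and, for i ≠ k, z'_i = z_i·z_k^{[−b_ki]_+} if β_k > 0, z'_i = z_i·z_k^{[b_ki]_+}·(1 + z_k)^{−b_ki} if β_k = 0, and z'_i = z_i·z_k^{[b_ki]_+} if β_k < 0. Set Q'_k = T_k and Q'_i = Q_i for i ≠ k, and let N'_f(i), N'_a(i), β'_i be computed from (B', N'). Then for every node i, the polynomial Q'_i divides ∏_j (Q'_j)^{[b'_ij]_+} + 𝒾^{β'_i}·z'_i·∏_j (Q'_j)^{[−b'_ij]_+} in ℂ[x]. -/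
open Polynomial in
lemma core_dvd (q D X Y A1 A2 t : Polynomial ℂ) (u v w w' : ℂ) (hD : IsCoprime q D)
    (h1 : q ∣ D * X - C u * t * A1) (h2 : q ∣ D * Y - C v * t * A2)
    (hA : q ∣ A1 + C w * A2) (hw : w' * v = u * w) : q ∣ X + C w' * Y := by
  have hC : (C w' : Polynomial ℂ) * C v = C u * C w := by rw [← C_mul, ← C_mul, hw]
  apply hD.dvd_of_dvd_mul_left
  have : D * (X + C w' * Y) = (D * X - C u * t * A1) + C w' * (D * Y - C v * t * A2)
      + C u * t * (A1 + C w * A2) := by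
    linear_combination (t * A2) * hC
  rw [this]
  exact dvd_add (dvd_add h1 (h2.mul_left _)) (hA.mul_left _)

lemma prods_eq {n : ℕ} (Q Q' : Fin n → Polynomial ℂ) (k : Fin n)
    (hQ' : ∀ j, j ≠ k → Q' j = Q j) (e x y a1 a2 p : Fin n → ℕ) (b : ℕ)
    (h1 : ∀ j, e j + x j = a1 j + b * p j) (hx : x k = 0)
    (h2 : ∀ j, j ≠ k → e j + y j = a2 j) (he : e k = b) (hy : y k = b) (ha : a2 k = 0) :
    (∏ j, Q j ^ e j) * ∏ j, Q' j ^ x j = (∏ j, Q j ^ a1 j) * (∏ j, Q j ^ p j) ^ b ∧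
    (∏ j, Q j ^ e j) * ∏ j, Q' j ^ y j = (Q k * Q' k) ^ b * ∏ j, Q j ^ a2 j := by
  constructor
  · rw [← Finset.prod_pow, ← Finset.prod_mul_distrib, ← Finset.prod_mul_distrib]
    refine Finset.prod_congr rfl fun j _ => ?_
    rw [← pow_mul, ← pow_add, mul_comm (p j), ← h1 j]
    by_cases hj : j = k
    · subst hj; simp [hx]
    · rw [hQ' j hj, pow_add]
  · have : (Q k * Q' k) ^ b = ∏ j, (if j = k then (Q k * Q' k) ^ b else 1) := by simp
    rw [this, ← Finset.prod_mul_distrib, ← Finset.prod_mul_distrib]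
    refine Finset.prod_congr rfl fun j _ => ?_
    by_cases hj : j = k
    · subst hj; simp [he, hy, ha, mul_pow]
    · rw [hQ' j hj, ← pow_add, h2 j hj]; simp [hj]

lemma coprime_prod {n : ℕ} (Q : Fin n → Polynomial ℂ) (q : Polynomial ℂ) (e : Fin n → ℕ)
    (h : ∀ j, e j ≠ 0 → IsCoprime q (Q j)) : IsCoprime q (∏ j, Q j ^ e j) := by
  refine IsCoprime.prod_right fun j _ => ?_
  by_cases hj : e j = 0
  · simp [hj, isCoprime_one_right]
  · exact (h j hj).pow_right

lemma beta_eq {n : ℕ} (M : Fin n → ℤ) (N : Fin n → ℤ) :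
    (∑ j, max (-(M j)) 0 * N j) - ∑ j, max (M j) 0 * N j = -∑ j, M j * N j := by
  rw [← Finset.sum_sub_distrib, ← Finset.sum_neg_distrib]
  refine Finset.sum_congr rfl fun j _ => ?_
  have : M j = max (M j) 0 - max (-(M j)) 0 := by omega
  linear_combination (N j) * this


open Polynomial in
theorem stmt12 (n : ℕ) (hn : 1 ≤ n) (B B' : Fin n → Fin n → ℤ)
    (hskew : ∀ i j, B j i = -B i j)
    (N N' : Fin n → ℕ) (z z' : Fin n → ℂ) (hz : ∀ i, z i ≠ 0)
    (Nf Na β Nf' Na' β' : Fin n → ℤ)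
    (hNf : ∀ i, Nf i = ∑ j, max (B i j) 0 * (N j : ℤ))
    (hNa : ∀ i, Na i = ∑ j, max (-(B i j)) 0 * (N j : ℤ))
    (hβ : ∀ i, β i = Na i - Nf i)
    (Cf : Fin n → ℂ)
    (hCf : ∀ i, Cf i = if β i < 0 then 1 else if β i = 0 then 1 + z i
        else Complex.I ^ β i * z i)
    (hzne : ∀ i, β i = 0 → z i ≠ -1)
    (Q T : Fin n → Polynomial ℂ)
    (hQmonic : ∀ i, (Q i).Monic) (hQdeg : ∀ i, (Q i).natDegree = N i)
    (hTmonic : ∀ i, (T i).Monic)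
    (hTdeg : ∀ i, ((T i).natDegree : ℤ) = max (Nf i) (Na i) - (N i : ℤ))
    (heq : ∀ i, (∏ j, Q j ^ (max (B i j) 0).toNat)
        + C (Complex.I ^ β i * z i) * ∏ j, Q j ^ (max (-(B i j)) 0).toNat
      = C (Cf i) * Q i * T i)
    (hsf : ∀ i, Squarefree (Q i))
    (hcop : ∀ i j, B i j ≠ 0 → IsCoprime (Q i) (Q j))
    (k : Fin n) (hk : (N k : ℤ) ≤ max (Nf k) (Na k))
    (hB' : ∀ i j, B' i j = if i = k ∨ j = k then -B i j
        else B i j + Int.sign (B i k) * max (B i k * B k j) 0)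
    (hN' : ∀ i, N' i = if i = k then (max (Nf k) (Na k) - (N k : ℤ)).toNat else N i)
    (hz' : ∀ i, z' i = if i = k then (z k)⁻¹
        else if 0 < β k then z i * z k ^ max (-(B k i)) 0
        else if β k = 0 then z i * z k ^ max (B k i) 0 * (1 + z k) ^ (-(B k i))
        else z i * z k ^ max (B k i) 0)
    (Q' : Fin n → Polynomial ℂ)
    (hQ' : ∀ i, Q' i = if i = k then T k else Q i)
    (hNf' : ∀ i, Nf' i = ∑ j, max (B' i j) 0 * (N' j : ℤ))
    (hNa' : ∀ i, Na' i = ∑ j, max (-(B' i j)) 0 * (N' j : ℤ))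
    (hβ' : ∀ i, β' i = Na' i - Nf' i) :
    ∀ i, Q' i ∣ ((∏ j, Q' j ^ (max (B' i j) 0).toNat)
        + C (Complex.I ^ β' i * z' i) * ∏ j, Q' j ^ (max (-(B' i j)) 0).toNat) := by
  intro i
  have hBkk : ∀ j, B j j = 0 := fun j => by have := hskew j j; omega
  have hQ'k : Q' k = T k := by simp [hQ']
  have hQ'ne : ∀ j, j ≠ k → Q' j = Q j := fun j hj => by simp [hQ', hj]
  have hI : Complex.I ≠ 0 := Complex.I_ne_zero
  have hbeta : ∀ i, β i = -∑ j, B i j * (N j : ℤ) := fun i => by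
    rw [hβ, hNa, hNf]; exact beta_eq (B i) (fun j => (N j : ℤ))
  have hbeta' : ∀ i, β' i = -∑ j, B' i j * (N' j : ℤ) := fun i => by
    rw [hβ', hNa', hNf']; exact beta_eq (B' i) (fun j => (N' j : ℤ))
  have hN'k : (N' k : ℤ) = max (Nf k) (Na k) - (N k : ℤ) := by
    rw [hN']; simp only [if_true]; omega
  have hN'ne : ∀ j, j ≠ k → N' j = N j := fun j hj => by simp [hN', hj]
  have hA : Q i ∣ (∏ j, Q j ^ (max (B i j) 0).toNat)
      + C (Complex.I ^ β i * z i) * ∏ j, Q j ^ (max (-(B i j)) 0).toNat := by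
    rw [heq i]; exact ⟨C (Cf i) * T i, by ring⟩
  have hE := heq k
  by_cases hik : i = k
  · subst hik
    have hB'i : ∀ j, B' i j = -B i j := fun j => by simp [hB']
    have hb : β' i = -β i := by
      rw [hbeta', hbeta, neg_neg, ← Finset.sum_neg_distrib]
      refine Finset.sum_congr rfl fun j _ => ?_
      by_cases hj : j = i
      · subst hj; simp [hB'i, hBkk]
      · rw [hN'ne j hj, hB'i]; ring
    have hp : ∀ f : ℤ → ℕ, f 0 = 0 → ∏ j, Q' j ^ f (B i j) = ∏ j, Q j ^ f (B i j) := by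
      intro f hf
      refine Finset.prod_congr rfl fun j _ => ?_
      by_cases hj : j = i
      · subst hj; simp [hBkk, hf]
      · rw [hQ'ne j hj]
    have hp1 := hp (fun m => (max m 0).toNat) (by simp)
    have hp2 := hp (fun m => (max (-m) 0).toNat) (by simp)
    simp only [hB'i, neg_neg, hp1, hp2, hQ'k, hb]
    have hz'i : z' i = (z i)⁻¹ := by simp [hz']
    refine ⟨C (Complex.I ^ (-β i) * (z i)⁻¹) * C (Cf i) * Q i, ?_⟩
    have hc : (C (Complex.I ^ (-β i) * (z i)⁻¹) : Polynomial ℂ) * C (Complex.I ^ β i * z i) = 1 := by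
      rw [← C_mul, ← C_1]; congr 1
      rw [zpow_neg]
      have := zpow_ne_zero (β i) hI
      have := hz i
      field_simp
    rw [hz'i]
    linear_combination (C (Complex.I ^ (-β i) * (z i)⁻¹)) * hE
      - (∏ j, Q j ^ (max (-(B i j)) 0).toNat) * hc
  rw [hQ'ne i hik]
  have hki := hskew i k
  have hz'i := hz' i
  simp only [hik, if_false] at hz'i
  have hB'k : B' i k = -B i k := by simp [hB']
  have hB'j : ∀ j, j ≠ k → B' i j = B i j + Int.sign (B i k) * max (B i k * B k j) 0 :=
    fun j hj => by simp [hB', hj, hik]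
  have hmk := hskew k k
  rcases lt_trichotomy (B i k) 0 with hb | hb | hb
  · -- negative
    obtain ⟨c, hc⟩ := Int.eq_ofNat_of_zero_le (show 0 ≤ -B i k by omega)
    have hc' : B i k = -(c : ℤ) := by omega
    have hcpos : 0 < c := by omega
    have hBj : ∀ j, j ≠ k → B' i j = B i j - c * max (-(B k j)) 0 := fun j hj => by
      rw [hB'j j hj, Int.sign_eq_neg_one_of_neg hb, hc']
      have : max (-(c : ℤ) * B k j) 0 = c * max (-(B k j)) 0 := by
        rw [mul_max_of_nonneg _ _ (by positivity)]; simp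
      rw [this]; ring
    have hβi : β' i = β i + c * min 0 (β k) := by
      have hs : ∑ j, B' i j * (N' j : ℤ) = ∑ j, (B i j * (N j : ℤ)
          - c * (max (-(B k j)) 0 * (N j : ℤ)) + if j = k then c * ((N' k : ℤ) + N k) else 0) := by
        refine Finset.sum_congr rfl fun j _ => ?_
        by_cases hj : j = k
        · subst hj; simp [hB'k, hBkk, hc']; ring
        · rw [hN'ne j hj, hBj j hj]; simp [hj]; ring
      rw [hbeta' i, hs, Finset.sum_add_distrib, Finset.sum_sub_distrib, ← Finset.mul_sum, ← hNa k,
        Finset.sum_ite_eq' , hN'k, hbeta i]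
      simp only [Finset.mem_univ, if_true]
      have : min 0 (β k) = Na k - max (Nf k) (Na k) := by rw [hβ]; omega
      rw [this]; ring
    let e : Fin n → ℕ := fun j =>
      (max (-(B i j)) 0 + c * max (-(B k j)) 0 - max (-(B' i j)) 0).toNat
    have key : ∀ j, 0 ≤ (c : ℤ) * max (-(B k j)) 0 := fun j => by positivity
    have hek : e k = c := by simp only [e, hBkk, hB'k, hc']; simp
    have hcopD : IsCoprime (Q i) (∏ j, Q j ^ e j) := by
      refine coprime_prod Q _ e fun j hj => hcop i j fun h0 => hj ?_
      by_cases hjk : j = k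
      · subst hjk; omega
      · have := hBj j hjk; have := key j; simp only [e]; omega
    obtain ⟨hY, hX⟩ := prods_eq Q Q' k hQ'ne e (fun j => (max (-(B' i j)) 0).toNat)
      (fun j => (max (B' i j) 0).toNat) (fun j => (max (-(B i j)) 0).toNat)
      (fun j => (max (B i j) 0).toNat) (fun j => (max (-(B k j)) 0).toNat) c
      (by
        intro j
        zify
        have h1 : (((max (-(B k j)) 0).toNat : ℕ) : ℤ) = max (-(B k j)) 0 := by omega
        rw [h1]
        by_cases hjk : j = k
        · subst hjk; rw [hek]; simp [hB'k, hBkk, hc']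
        · have := hBj j hjk; have := key j; simp only [e]; omega)
      (by omega)
      (by intro j hjk; have := hBj j hjk; have := key j; simp only [e]; omega)
      hek (by omega) (by omega)
    rw [hQ'k] at hX
    set P1 := ∏ j, Q j ^ (max (B k j) 0).toNat
    set P2 := ∏ j, Q j ^ (max (-(B k j)) 0).toNat
    have hP1 : Q i ∣ P1 := by
      refine (dvd_pow_self (Q i) ?_).trans (Finset.dvd_prod_of_mem _ (Finset.mem_univ i))
      omega
    set g : ℂ := Complex.I ^ β k * z k with hg
    have hg0 : g ≠ 0 := mul_ne_zero (zpow_ne_zero _ hI) (hz k)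
    have hP2 : Q i ∣ P2 - C (Cf k / g) * (Q k * T k) := by
      have hcc : (C g⁻¹ : Polynomial ℂ) * C g = 1 := by rw [← C_mul, inv_mul_cancel₀ hg0, C_1]
      have : P2 - C (Cf k / g) * (Q k * T k) = P1 * (-C g⁻¹) := by
        rw [div_eq_mul_inv, C_mul]
        linear_combination (C g⁻¹) * hE - P2 * hcc
      rw [this]; exact hP1.mul_right _
    have hpow := hP2.trans (sub_dvd_pow_sub_pow _ _ c)
    rw [mul_pow, ← C_pow] at hpow
    refine core_dvd (Q i) _ _ _ _ _ ((Q k * T k) ^ c) 1 ((Cf k / g) ^ c) _ _ hcopD ?_ ?_ hA ?_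
    · rw [hX]; simp
    · rw [hY]
      refine (hpow.mul_left (∏ j, Q j ^ (max (-(B i j)) 0).toNat)).trans (dvd_of_eq ?_)
      ring
    · have hkc : B k i = c := by omega
      have hm1 : max (B k i) 0 = c := by omega
      have hm2 : max (-(B k i)) 0 = 0 := by omega
      rw [hz'i, hm1, hm2, hkc, hβi, hCf k, zpow_add₀ hI, zpow_mul', one_mul]
      have hIb := zpow_ne_zero (β k) hI
      have hzk := hz k
      rcases lt_trichotomy (β k) 0 with h | h | h
      · have h1 : ¬ (0 < β k) := by omega
        have h2 : β k ≠ 0 := by omega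
        rw [min_eq_right h.le]
        simp only [h, h1, h2, if_true, if_false, zpow_natCast, hg, one_div, mul_inv, mul_pow,
          inv_pow]
        field_simp
      · have h4 : 1 + z k ≠ 0 := fun h5 => hzne k h (by linear_combination h5)
        simp only [h, lt_irrefl, if_true, if_false, min_self, hg, zpow_natCast, zpow_neg, zpow_zero,
          one_mul, one_pow, div_pow]
        field_simp
      · have h1 : ¬ (β k < 0) := by omega
        have h2 : β k ≠ 0 := by omega
        rw [min_eq_left h.le]
        simp only [h, h1, h2, if_true, if_false]
        rw [← hg, div_self hg0]
        simp
  · -- zero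
    have hBj : ∀ j, B' i j = B i j := fun j => by
      by_cases hj : j = k
      · subst hj; omega
      · rw [hB'j j hj, hb]; simp
    have hb' : β' i = β i := by
      rw [hbeta', hbeta]
      congr 1
      refine Finset.sum_congr rfl fun j _ => ?_
      by_cases hj : j = k
      · subst hj; simp [hBj, hb]
      · rw [hN'ne j hj, hBj]
    have hp : ∀ f : ℤ → ℕ, f 0 = 0 → ∏ j, Q' j ^ f (B i j) = ∏ j, Q j ^ f (B i j) := by
      intro f hf
      refine Finset.prod_congr rfl fun j _ => ?_
      by_cases hj : j = k
      · subst hj; simp [hb, hf]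
      · rw [hQ'ne j hj]
    have hp1 := hp (fun m => (max m 0).toNat) (by simp)
    have hp2 := hp (fun m => (max (-m) 0).toNat) (by simp)
    have hzz : z' i = z i := by
      rw [hz'i, show B k i = 0 by omega]; simp
    simp only [hBj, hb', hp1, hp2, hzz]
    exact hA
  · -- positive
    obtain ⟨c, hc'⟩ := Int.eq_ofNat_of_zero_le hb.le
    have hcpos : 0 < c := by omega
    have hBj : ∀ j, j ≠ k → B' i j = B i j + c * max (B k j) 0 := fun j hj => by
      rw [hB'j j hj, Int.sign_eq_one_of_pos hb, hc']
      have : max ((c : ℤ) * B k j) 0 = c * max (B k j) 0 := by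
        rw [mul_max_of_nonneg _ _ (by positivity)]; simp
      rw [this]; ring
    have hβi : β' i = β i + c * max 0 (β k) := by
      have hs : ∑ j, B' i j * (N' j : ℤ) = ∑ j, (B i j * (N j : ℤ)
          + c * (max (B k j) 0 * (N j : ℤ)) + if j = k then -c * ((N' k : ℤ) + N k) else 0) := by
        refine Finset.sum_congr rfl fun j _ => ?_
        by_cases hj : j = k
        · subst hj; simp [hB'k, hBkk, hc']; ring
        · rw [hN'ne j hj, hBj j hj]; simp [hj]; ring
      rw [hbeta' i, hs, Finset.sum_add_distrib, Finset.sum_add_distrib, ← Finset.mul_sum, ← hNf k,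
        Finset.sum_ite_eq' , hN'k, hbeta i]
      simp only [Finset.mem_univ, if_true]
      have : max 0 (β k) = max (Nf k) (Na k) - Nf k := by rw [hβ]; omega
      rw [this]; ring
    let e : Fin n → ℕ := fun j =>
      (max (B i j) 0 + c * max (B k j) 0 - max (B' i j) 0).toNat
    have key : ∀ j, 0 ≤ (c : ℤ) * max (B k j) 0 := fun j => by positivity
    have hek : e k = c := by simp only [e, hBkk, hB'k, hc']; simp
    have hcopD : IsCoprime (Q i) (∏ j, Q j ^ e j) := by
      refine coprime_prod Q _ e fun j hj => hcop i j fun h0 => hj ?_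
      by_cases hjk : j = k
      · subst hjk; omega
      · have := hBj j hjk; have := key j; simp only [e]; omega
    obtain ⟨hX, hY⟩ := prods_eq Q Q' k hQ'ne e (fun j => (max (B' i j) 0).toNat)
      (fun j => (max (-(B' i j)) 0).toNat) (fun j => (max (B i j) 0).toNat)
      (fun j => (max (-(B i j)) 0).toNat) (fun j => (max (B k j) 0).toNat) c
      (by
        intro j
        zify
        have h1 : (((max (B k j) 0).toNat : ℕ) : ℤ) = max (B k j) 0 := by omega
        rw [h1]
        by_cases hjk : j = k
        · subst hjk; rw [hek]; simp [hB'k, hBkk, hc']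
        · have := hBj j hjk; have := key j; simp only [e]; omega)
      (by omega)
      (by intro j hjk; have := hBj j hjk; have := key j; simp only [e]; omega)
      hek (by omega) (by omega)
    rw [hQ'k] at hY
    set P1 := ∏ j, Q j ^ (max (B k j) 0).toNat
    set P2 := ∏ j, Q j ^ (max (-(B k j)) 0).toNat
    have hP2 : Q i ∣ P2 := by
      refine (dvd_pow_self (Q i) ?_).trans (Finset.dvd_prod_of_mem _ (Finset.mem_univ i))
      omega
    have hP1 : Q i ∣ P1 - C (Cf k) * (Q k * T k) := by
      have : P1 - C (Cf k) * (Q k * T k) = P2 * (-C (Complex.I ^ β k * z k)) := by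
        linear_combination hE
      rw [this]; exact hP2.mul_right _
    have hpow := hP1.trans (sub_dvd_pow_sub_pow _ _ c)
    rw [mul_pow, ← C_pow] at hpow
    refine core_dvd (Q i) _ _ _ _ _ ((Q k * T k) ^ c) (Cf k ^ c) 1 _ _ hcopD ?_ ?_ hA ?_
    · rw [hX]
      refine (hpow.mul_left (∏ j, Q j ^ (max (B i j) 0).toNat)).trans (dvd_of_eq ?_)
      ring
    · rw [hY]; simp
    · have hkc : B k i = -(c : ℤ) := by omega
      have hm1 : max (B k i) 0 = 0 := by omega
      have hm2 : max (-(B k i)) 0 = c := by omega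
      rw [hz'i, hm1, hm2, hkc, hβi, hCf k, zpow_add₀ hI, zpow_mul', mul_one]
      rcases lt_trichotomy (β k) 0 with h | h | h
      · have h1 : ¬ (0 < β k) := by omega
        have h2 : β k ≠ 0 := by omega
        rw [max_eq_left h.le]
        simp [h, h1, h2]
      · simp [h]; ring
      · have h1 : ¬ (β k < 0) := by omega
        have h2 : β k ≠ 0 := by omega
        rw [max_eq_right h.le]
        simp only [h, h1, h2, if_true, if_false, zpow_natCast, mul_pow]
        ring
end

section
/- Let q ∈ ℂ with q ≠ 1 and q ≠ −1, let c ∈ ℂ, and let Q, Q' ∈ ℂ[x] be polynomials. Define P(x) = (1 − q)^{−1}·(Q(x + c)·Q'(x − c) − q·Q(x − c)·Q'(x + c)) and T(x) = (1 − q²)^{−1}·(Q(x + 2c)·Q'(x − 2c) − q²·Q(x − 2c)·Q'(x + 2c)). Then P(x − c)·Q(x + 2c) + q·P(x + c)·Q(x − 2c) = (1 + q)·Q(x)·T(x) as an identity of polynomials. -/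
open Polynomial in
theorem stmt15 (q c : ℂ) (hq1 : q ≠ 1) (hq2 : q ≠ -1) (Q Q' P T : Polynomial ℂ)
    (hP : P = C (1 - q)⁻¹ * (Q.comp (X + C c) * Q'.comp (X - C c)
        - C q * (Q.comp (X - C c) * Q'.comp (X + C c))))
    (hT : T = C (1 - q ^ 2)⁻¹ * (Q.comp (X + C (2 * c)) * Q'.comp (X - C (2 * c))
        - C (q ^ 2) * (Q.comp (X - C (2 * c)) * Q'.comp (X + C (2 * c))))) :
    P.comp (X - C c) * Q.comp (X + C (2 * c))
        + C q * (P.comp (X + C c) * Q.comp (X - C (2 * c)))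
      = C (1 + q) * Q * T := by
  have h1 : (1 - q) ≠ 0 := sub_ne_zero.mpr (Ne.symm hq1)
  have h2 : (1 + q) ≠ 0 := fun h => hq2 (by linear_combination h)
  have h3 : (1 - q ^ 2)⁻¹ = (1 - q)⁻¹ * (1 + q)⁻¹ := by
    rw [← mul_inv]; congr 1; ring
  apply Polynomial.funext
  intro x
  subst hP hT
  rw [h3]
  simp only [eval_add, eval_mul, eval_sub, eval_comp, eval_C, eval_X]
  have e1 : x - c + c = x := by ring
  have e2 : x - c - c = x - 2 * c := by ring
  have e3 : x + c + c = x + 2 * c := by ring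
  have e4 : x + c - c = x := by ring
  rw [e1, e2, e3, e4]
  field_simp
  ring
end

section
/- Let N_f ≥ 1, 0 ≤ N ≤ N_f, q ∈ ℂ with q ≠ 1, c ∈ ℂ, and s_1,…,s_{N_f} ∈ ℂ. Let P(x) = ∏_{F=1}^{N_f}(x − s_F), let Q ∈ ℂ[x] be monic of degree N, and let Q' ∈ ℂ[x] be monic of degree N_f − N, and suppose (1 − q)·P(x) = Q(x + c)·Q'(x − c) − q·Q(x − c)·Q'(x + c). Then the sum of the roots of Q (with multiplicity) plus the sum of the roots of Q' (with multiplicity) equals ∑_{F=1}^{N_f} s_F + c·(2N − N_f)·(1 + q)/(1 − q). -/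
open Polynomial in
theorem aux_shift (Q : Polynomial ℂ) (h : Q.Monic) (a : ℂ) :
    (Q.comp (X + C a)).Monic ∧ (Q.comp (X + C a)).natDegree = Q.natDegree ∧
    (Q.comp (X + C a)).nextCoeff = - Q.roots.sum + Q.natDegree * a := by
  have hs := IsAlgClosed.splits Q
  have hcard : Q.natDegree = Q.roots.card := hs.natDegree_eq_card_roots
  have hm : (Q.comp (X + C a)).Monic := h.comp_X_add_C a
  have hQ : Q = (Q.roots.map (fun r => X - C r)).prod := hs.eq_prod_roots_of_monic h
  have hc : Q.comp (X + C a) = ((Q.roots.map (fun r => r - a)).map (fun r => X - C r)).prod := by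
    conv_lhs => rw [hQ]
    rw [Polynomial.multiset_prod_comp, Multiset.map_map, Multiset.map_map]
    congr 1
    apply Multiset.map_congr rfl
    intro r _
    simp only [Function.comp, sub_comp, X_comp, C_comp, C_sub]
    ring
  refine ⟨hm, by simp [natDegree_comp], ?_⟩
  rw [hc, multiset_prod_X_sub_C_nextCoeff, Multiset.sum_map_sub, hcard]
  simp
  ring

open Polynomial in
theorem stmt17 (Nf N : ℕ) (hNf : 1 ≤ Nf) (hN : N ≤ Nf) (q c : ℂ) (hq : q ≠ 1)
    (s : Fin Nf → ℂ) (P Q Q' : Polynomial ℂ)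
    (hP : P = ∏ F, (X - C (s F)))
    (hQm : Q.Monic) (hQd : Q.natDegree = N)
    (hQ'm : Q'.Monic) (hQ'd : Q'.natDegree = Nf - N)
    (heq : C (1 - q) * P = Q.comp (X + C c) * Q'.comp (X - C c)
        - C q * (Q.comp (X - C c) * Q'.comp (X + C c))) :
    Q.roots.sum + Q'.roots.sum
      = (∑ F, s F) + c * (2 * (N : ℂ) - (Nf : ℂ)) * (1 + q) / (1 - q) := by
  have hX : (X - C c : Polynomial ℂ) = X + C (-c) := by rw [C_neg, sub_eq_add_neg]
  rw [hX] at heq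
  have key : ∀ a b : ℂ, (Q.comp (X + C a) * Q'.comp (X + C b)).coeff (Nf - 1)
      = (- Q.roots.sum + N * a) + (- Q'.roots.sum + ((Nf : ℂ) - N) * b) := by
    intro a b
    obtain ⟨m1, d1, n1⟩ := aux_shift Q hQm a
    obtain ⟨m2, d2, n2⟩ := aux_shift Q' hQ'm b
    have hd : (Q.comp (X + C a) * Q'.comp (X + C b)).natDegree = Nf := by
      rw [m1.natDegree_mul m2, d1, d2]; omega
    have := m1.nextCoeff_mul m2
    rw [nextCoeff_of_natDegree_pos (by omega), hd, n1, n2, hQd, hQ'd, Nat.cast_sub hN] at this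
    exact this
  have hPc : P.coeff (Nf - 1) = - ∑ F, s F := by
    have hd : P.natDegree = Nf := by rw [hP, natDegree_finsetProd_X_sub_C_eq_card]; simp
    have := prod_X_sub_C_nextCoeff (s := Finset.univ) s
    rw [← hP, nextCoeff_of_natDegree_pos (by omega), hd] at this
    exact this
  have h := congrArg (fun p => p.coeff (Nf - 1)) heq
  simp only [coeff_sub, coeff_C_mul, key, hPc] at h
  have h1 : (1 - q) ≠ 0 := sub_ne_zero.mpr hq.symm
  field_simp
  linear_combination h
end

section
/- Let n ≥ 1, let B = (b_ij) be an n×n skew-symmetric integer matrix regarded as a complex matrix, fix an index k, and let w ∈ ℂ be arbitrary. Define the n×n complex matrix E by E_{ia} = δ_{ia} for i ≠ k and a ≠ k, E_{ik} = [b_ki]_+ − b_ki·w for i ≠ k, E_{kk} = −1, and E_{ka} = 0 for a ≠ k. Then E·B·Eᵀ = μ_k(B), where μ_k(B) is the mutated matrix regarded as a complex matrix. -/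
theorem int_aux (x y : ℤ) :
    max (-x) 0 * y + max y 0 * x = Int.sign x * max (x * y) 0 := by
  rcases lt_trichotomy x 0 with hx | hx | hx
  · rw [Int.sign_eq_neg_one_of_neg hx, max_eq_left (by omega : (0 : ℤ) ≤ -x)]
    rcases le_total y 0 with hy | hy
    · rw [max_eq_right hy, max_eq_left (by nlinarith)]; ring
    · rw [max_eq_left hy, max_eq_right (by nlinarith)]; ring
  · subst hx; simp
  · rw [Int.sign_eq_one_of_pos hx, max_eq_right (by omega : -x ≤ (0 : ℤ))]
    rcases le_total y 0 with hy | hy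
    · rw [max_eq_right hy, max_eq_right (by nlinarith)]; ring
    · rw [max_eq_left hy, max_eq_left (by nlinarith)]; ring

open Matrix in
theorem stmt19 (n : ℕ) (hn : 1 ≤ n) (B : Fin n → Fin n → ℤ)
    (hskew : ∀ i j, B j i = -B i j) (k : Fin n) (w : ℂ)
    (Bc E M : Matrix (Fin n) (Fin n) ℂ)
    (hBc : ∀ i j, Bc i j = (B i j : ℂ))
    (hE : ∀ i a, E i a =
      if i = k then (if a = k then -1 else 0)
      else if a = k then ((max (B k i) 0 : ℤ) : ℂ) - (B k i : ℂ) * w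
      else if i = a then 1 else 0)
    (hM : ∀ i j, M i j = ((if i = k ∨ j = k then -B i j
        else B i j + Int.sign (B i k) * max (B i k * B k j) 0 : ℤ) : ℂ)) :
    E * Bc * Eᵀ = M := by
  have key : ∀ (i : Fin n) (f : Fin n → ℂ), ∑ a, E i a * f a =
      if i = k then -f k
      else f i + (((max (B k i) 0 : ℤ) : ℂ) - (B k i : ℂ) * w) * f k := by
    intro i f
    by_cases hi : i = k
    · simp [hE, hi, ite_mul]
    · have h : ∀ a, E i a * f a = (if i = a then f a else 0) +
          (if a = k then (((max (B k i) 0 : ℤ) : ℂ) - (B k i : ℂ) * w) * f a else 0) := by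
        intro a
        rw [hE, if_neg hi]
        by_cases ha : a = k
        · have : i ≠ a := fun h => hi (h.trans ha)
          rw [if_pos ha, if_neg this, if_pos ha, zero_add]
        · rw [if_neg ha, if_neg ha, add_zero, ite_mul, one_mul, zero_mul]
      rw [Finset.sum_congr rfl (fun a _ => h a), Finset.sum_add_distrib, if_neg hi]
      simp
  have hkk : B k k = 0 := by have := hskew k k; omega
  ext i j
  have h1 : (E * Bc * Eᵀ) i j = ∑ b, E j b * ∑ a, E i a * Bc a b := by
    rw [Matrix.mul_apply]
    refine Finset.sum_congr rfl fun b _ => ?_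
    rw [Matrix.mul_apply, Matrix.transpose_apply, mul_comm]
  rw [h1, key j, hM]
  simp only [key i, hBc]
  by_cases hi : i = k
  · by_cases hj : j = k
    · simp [hi, hj, hkk]
    · simp [hi, hj, hkk]
  · by_cases hj : j = k
    · simp [hi, hj, hkk]
    · have h2 := int_aux (B i k) (B k j)
      rw [← hskew i k] at h2
      simp only [hi, hj, if_false, or_self, ← h2, hkk]
      have h3 : (B k i : ℂ) = -(B i k : ℂ) := by rw [hskew i k]; push_cast; rfl
      push_cast [h3]
      generalize max (B k i : ℤ) 0 = p
      ring
end
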